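/- arXiv:1407.8282 — 2 statements merged into one kernel-verified Lean document; each statement's English description precedes it below -/
import Mathlib

section
/- For every d ≥ 1 and every s with 0 < s < d, the Riesz s-energy of the normalised surface measure of S^d equals W_s(S^d) = ∫_{S^d} ∫_{S^d} ‖x - y‖^{-s} dσ_d(x) dσ_d(y) = 2^{d-1-s} · Γ((d+1)/2) · Γ((d-s)/2) / (√π · Γ(d - s/2)). -/
open MeasureTheory

/-- The normalised surface area measure `σ_d` on the unit sphere `S^d ⊂ ℝ^{d+1}`. -/
noncomputable def sphereMeasure (d : ℕ) :
    Measure (EuclideanSpace ℝ (Fin (d + 1))) :=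
  (μH[(d : ℝ)] (Metric.sphere (0 : EuclideanSpace ℝ (Fin (d + 1))) 1))⁻¹ •
    (μH[(d : ℝ)]).restrict (Metric.sphere (0 : EuclideanSpace ℝ (Fin (d + 1))) 1)

lemma aux_haar (d : ℕ) (x : EuclideanSpace ℝ (Fin (d + 1))) (hx : ‖x‖ = 1) :
    Measure.IsAddHaarMeasure (G := ((Submodule.span ℝ {x})ᗮ : Submodule ℝ (EuclideanSpace ℝ (Fin (d + 1))))) μH[(d:ℝ)] := by
  have hx0 : x ≠ 0 := by rintro rfl; simp at hx
  have : Fact (Module.finrank ℝ (EuclideanSpace ℝ (Fin (d + 1))) = d + 1) := ⟨by simp⟩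
  have := Submodule.finrank_orthogonal_span_singleton (𝕜 := ℝ) (n := d) hx0
  have h2 := isAddHaarMeasure_hausdorffMeasure (E := ((Submodule.span ℝ {x})ᗮ : Submodule ℝ (EuclideanSpace ℝ (Fin (d + 1)))))
  rwa [this] at h2

lemma aux_decomp {d : ℕ} (x : EuclideanSpace ℝ (Fin (d + 1))) (hx : ‖x‖ = 1) (y : EuclideanSpace ℝ (Fin (d + 1))) :
    y = (inner ℝ x y) • x + (((Submodule.span ℝ {x})ᗮ).orthogonalProjectionOnto y : EuclideanSpace ℝ (Fin (d + 1))) := by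
  have := Submodule.starProjection_add_starProjection_orthogonal (K := Submodule.span ℝ {x}) y
  rw [Submodule.starProjection_unit_singleton ℝ hx] at this
  exact this.symm

lemma aux_norm {d : ℕ} (x : EuclideanSpace ℝ (Fin (d + 1))) (hx : ‖x‖ = 1) (c : ℝ) (z : ((Submodule.span ℝ {x})ᗮ : Submodule ℝ (EuclideanSpace ℝ (Fin (d + 1))))) :
    ‖c • x + (z : EuclideanSpace ℝ (Fin (d + 1)))‖ ^ 2 = c ^ 2 + ‖z‖ ^ 2 := by
  have h : inner ℝ x (z : EuclideanSpace ℝ (Fin (d + 1))) = 0 :=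
    Submodule.mem_orthogonal_singleton_iff_inner_right.1 z.2
  rw [norm_add_sq_real, inner_smul_left, h, norm_smul, hx]
  simp

lemma aux_finite (d : ℕ) : 
    μH[(d : ℝ)] (Metric.sphere (0 : EuclideanSpace ℝ (Fin (d + 1))) 1) < ⊤ := by
  apply (isCompact_sphere _ _).measure_lt_top_of_nhdsWithin
  intro x hx
  have hx : ‖x‖ = 1 := by simpa using hx
  have := aux_haar d x hx
  set V := ((Submodule.span ℝ {x})ᗮ : Submodule ℝ (EuclideanSpace ℝ (Fin (d + 1)))) with hV
  let f : V → EuclideanSpace ℝ (Fin (d + 1)) := fun z => √(1 - ‖z‖ ^ 2) • x + (z : EuclideanSpace ℝ (Fin (d + 1)))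
  have hf : ContDiffAt ℝ 1 f 0 := by
    refine ContDiffAt.add (ContDiffAt.smul (ContDiffAt.sqrt ?_ ?_) contDiffAt_const) V.subtypeL.contDiff.contDiffAt
    · exact contDiffAt_const.sub (contDiff_norm_sq ℝ).contDiffAt
    · simp
  obtain ⟨K, t, ht, hK⟩ := hf.exists_lipschitzOnWith
  have hK' := hK.mono (Set.inter_subset_left (t := Metric.closedBall 0 1))
  refine ⟨f '' (t ∩ Metric.closedBall 0 1), ?_, ?_⟩
  · have h1 : ∀ᶠ y in nhds x, V.orthogonalProjectionOnto y ∈ t ∩ Metric.closedBall 0 1 := by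
      have hc : Filter.Tendsto (fun y => V.orthogonalProjectionOnto y) (nhds x) (nhds 0) := by
        have h0 : V.orthogonalProjectionOnto x = 0 := by
          apply Submodule.orthogonalProjectionOnto_orthogonal_apply_eq_zero
          exact Submodule.mem_span_singleton_self x
        rw [← h0]
        exact V.orthogonalProjectionOnto.continuous.tendsto x
      exact hc (Filter.inter_mem ht (Metric.closedBall_mem_nhds _ one_pos))
    have h2 : ∀ᶠ y in nhds x, 0 < inner ℝ x y := by
      apply ContinuousAt.eventually_lt (by fun_prop) (by fun_prop)
      simp [hx]
    filter_upwards [nhdsWithin_le_nhds h1, nhdsWithin_le_nhds h2, self_mem_nhdsWithin] with y hy1 hy2 hy3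
    refine ⟨_, hy1, ?_⟩
    have hy3 : ‖y‖ = 1 := by simpa using hy3
    have h4 := aux_norm x hx (inner ℝ x y) (V.orthogonalProjectionOnto y)
    rw [← aux_decomp x hx y, hy3] at h4
    simp only [f]
    rw [show 1 - ‖V.orthogonalProjectionOnto y‖ ^ 2 = (inner ℝ x y) ^ 2 by linarith, Real.sqrt_sq hy2.le]
    exact (aux_decomp x hx y).symm
  · refine (hK'.hausdorffMeasure_image_le (d := d) (by positivity)).trans_lt ?_
    refine ENNReal.mul_lt_top (ENNReal.rpow_lt_top_of_nonneg (by positivity) (by simp)) ?_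
    exact (measure_mono Set.inter_subset_right).trans_lt (isCompact_closedBall _ _).measure_lt_top

lemma aux_pos (d : ℕ) : 
    0 < μH[(d : ℝ)] (Metric.sphere (0 : EuclideanSpace ℝ (Fin (d + 1))) 1) := by
  let x : EuclideanSpace ℝ (Fin (d + 1)) := EuclideanSpace.single 0 1
  have hx : ‖x‖ = 1 := by simp [x]
  have := aux_haar d x hx
  set V := ((Submodule.span ℝ {x})ᗮ : Submodule ℝ (EuclideanSpace ℝ (Fin (d + 1)))) with hV
  refine lt_of_lt_of_le ?_ (hausdorffMeasure_orthogonalProjectionOnto_le V d _ (by positivity))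
  refine lt_of_lt_of_le (Metric.measure_closedBall_pos (μH[(d:ℝ)]) (0 : V) one_pos) (measure_mono ?_)
  intro z hz
  have hz : ‖z‖ ≤ 1 := by simpa using hz
  refine ⟨√(1 - ‖z‖ ^ 2) • x + (z : EuclideanSpace ℝ (Fin (d + 1))), ?_, ?_⟩
  · have := aux_norm x hx (√(1 - ‖z‖ ^ 2)) z
    rw [Real.sq_sqrt (by nlinarith [norm_nonneg z])] at this
    simp only [mem_sphere_iff_norm, sub_zero]
    rw [← sq_eq_sq₀ (by positivity) (by positivity)]
    linarith
  · have h0 : V.orthogonalProjectionOnto x = 0 := by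
      apply Submodule.orthogonalProjectionOnto_orthogonal_apply_eq_zero
      exact Submodule.mem_span_singleton_self x
    simp [h0]

noncomputable def auxF (s t q : ℝ) : ENNReal :=
  ENNReal.ofReal ((√(t ^ 2 + q) - t) ^ (-(s / 2)) * (Real.exp (-√(t ^ 2 + q)) / √(t ^ 2 + q)))

lemma auxF_meas (s : ℝ) : Measurable (fun p : ℝ × ℝ => auxF s p.1 p.2) := by
  unfold auxF
  fun_prop

lemma aux_split (d : ℕ) (G : ℝ → ℝ → ENNReal) (hG : Measurable (fun p : ℝ × ℝ => G p.1 p.2)) :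
    ∫⁻ y : EuclideanSpace ℝ (Fin (d + 1)), G (y 0) (∑ i : Fin d, y i.succ ^ 2) =
      ∫⁻ w : EuclideanSpace ℝ (Fin d), ∫⁻ t, G t (‖w‖ ^ 2) := by
  have h1 : ∫⁻ y : EuclideanSpace ℝ (Fin (d + 1)), G (y 0) (∑ i : Fin d, y i.succ ^ 2) =
      ∫⁻ y : Fin (d + 1) → ℝ, G (y 0) (∑ i : Fin d, y i.succ ^ 2) :=
    (PiLp.volume_preserving_ofLp (Fin (d + 1))).lintegral_comp
      (f := fun y : Fin (d + 1) → ℝ => G (y 0) (∑ i : Fin d, y i.succ ^ 2))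
      (hG.comp (f := fun y : Fin (d + 1) → ℝ => (y 0, ∑ i : Fin d, y i.succ ^ 2)) (by fun_prop))
  have h2 : ∫⁻ y : Fin (d + 1) → ℝ, G (y 0) (∑ i : Fin d, y i.succ ^ 2) =
      ∫⁻ p : ℝ × (Fin d → ℝ), G p.1 (∑ i : Fin d, p.2 i ^ 2) := by
    have := (volume_preserving_piFinSuccAbove (fun _ : Fin (d + 1) => ℝ) 0).lintegral_comp
      (f := fun p : ℝ × (Fin d → ℝ) => G p.1 (∑ i : Fin d, p.2 i ^ 2))
      (hG.comp (f := fun p : ℝ × (Fin d → ℝ) => (p.1, ∑ i : Fin d, p.2 i ^ 2)) (by fun_prop))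
    rw [← this]
    simp [MeasurableEquiv.piFinSuccAbove, Fin.insertNthEquiv, Fin.tail]
  rw [h1, h2, Measure.volume_eq_prod, lintegral_prod_symm']
  · have := (PiLp.volume_preserving_ofLp (Fin d)).lintegral_comp
      (f := fun w : Fin d → ℝ => ∫⁻ t, G t (∑ i : Fin d, w i ^ 2)) (by
        apply Measurable.lintegral_prod_left' (f := fun p : ℝ × (Fin d → ℝ) => G p.1 (∑ i : Fin d, p.2 i ^ 2))
        exact (hG.comp (f := fun p : ℝ × (Fin d → ℝ) => (p.1, ∑ i : Fin d, p.2 i ^ 2)) (by fun_prop)))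
    rw [← this]
    simp [EuclideanSpace.norm_sq_eq]
  · exact (hG.comp (f := fun p : ℝ × (Fin d → ℝ) => (p.1, ∑ i : Fin d, p.2 i ^ 2)) (by fun_prop))

lemma aux_subst (s q : ℝ) (hq : 0 < q) :
    ∫⁻ t, auxF s t q = ∫⁻ u in Set.Ioi (0:ℝ),
      ENNReal.ofReal (u ^ (-(s / 2) - 1) * Real.exp (-(u / 2)) * Real.exp (-(1 / (2 * u)) * q)) := by
  let f : ℝ → ℝ := fun u => (q / u - u) / 2
  let f' : ℝ → ℝ := fun u => (-(q / u ^ 2) - 1) / 2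
  have hsq : ∀ u : ℝ, 0 < u → √(f u ^ 2 + q) = (q / u + u) / 2 := by
    intro u hu
    rw [show f u ^ 2 + q = ((q / u + u) / 2) ^ 2 by simp only [f]; field_simp; ring]
    exact Real.sqrt_sq (by positivity)
  have him : f '' Set.Ioi 0 = Set.univ := by
    apply Set.eq_univ_of_forall
    intro t
    have h0 : 0 < t ^ 2 + q := by positivity
    have h1 : 0 < √(t ^ 2 + q) - t := by
      have : |t| < √(t ^ 2 + q) := by
        apply Real.lt_sqrt_of_sq_lt
        rw [sq_abs]; linarith
      linarith [le_abs_self t]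
    refine ⟨√(t ^ 2 + q) - t, h1, ?_⟩
    simp only [f]
    have h2 := Real.sq_sqrt h0.le
    rw [div_sub' h1.ne', div_div, div_eq_iff (by positivity)]
    nlinarith
  have hinj : Set.InjOn f (Set.Ioi 0) := by
    intro a (ha : 0 < a) b (hb : 0 < b) hab
    have h1 := hsq a ha
    have h2 := hsq b hb
    rw [hab, h2] at h1
    simp only [f] at hab
    linarith
  have hder : ∀ x ∈ Set.Ioi (0:ℝ), HasDerivWithinAt f (f' x) (Set.Ioi 0) x := by
    intro x (hx : 0 < x)
    apply HasDerivAt.hasDerivWithinAt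
    have := (((hasDerivAt_inv hx.ne').const_mul q).sub (hasDerivAt_id x)).div_const 2
    refine this.congr_deriv ?_
    simp only [f']
    field_simp
  have := lintegral_image_eq_lintegral_abs_deriv_mul measurableSet_Ioi hder hinj (fun t => auxF s t q)
  rw [him, setLIntegral_univ] at this
  rw [this]
  refine setLIntegral_congr_fun measurableSet_Ioi ?_
  intro u (hu : 0 < u)
  simp only [auxF]
  rw [hsq u hu, ← ENNReal.ofReal_mul (abs_nonneg _)]
  congr 1
  rw [show (q / u + u) / 2 - f u = u by simp only [f]; ring, Real.rpow_sub hu, Real.rpow_one,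
    show |f' u| = (q / u ^ 2 + 1) / 2 by
      rw [show f' u = - ((q / u ^ 2 + 1) / 2) by simp only [f']; ring, abs_neg, abs_of_pos (by positivity)],
    mul_assoc (_ / u), ← Real.exp_add, show -(u / 2) + -(1 / (2 * u)) * q = -((q / u + u) / 2) by field_simp; ring]
  field_simp

lemma aux_gauss (d : ℕ) (u : ℝ) (hu : 0 < u) :
    ∫⁻ w : EuclideanSpace ℝ (Fin d), ENNReal.ofReal (Real.exp (-(1 / (2 * u)) * ‖w‖ ^ 2)) =
      ENNReal.ofReal ((2 * Real.pi) ^ ((d : ℝ) / 2) * u ^ ((d : ℝ) / 2)) := by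
  have h := GaussianFourier.integral_rexp_neg_mul_sq_norm (V := EuclideanSpace ℝ (Fin d)) (b := 1 / (2 * u)) (by positivity)
  rw [finrank_euclideanSpace_fin, show Real.pi / (1 / (2 * u)) = (2 * Real.pi) * u by field_simp,
    Real.mul_rpow (by positivity) hu.le] at h
  rw [← h, ofReal_integral_eq_lintegral_ofReal]
  · by_contra hn
    rw [integral_undef hn] at h
    have : 0 < (2 * Real.pi) ^ ((d : ℝ) / 2) * u ^ ((d : ℝ) / 2) := by positivity
    linarith
  · exact Filter.Eventually.of_forall fun _ => (Real.exp_pos _).le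

lemma aux_gamma (a r : ℝ) (ha : 0 < a) (hr : 0 < r) :
    ∫⁻ t in Set.Ioi (0:ℝ), ENNReal.ofReal (t ^ (a - 1) * Real.exp (-(r * t))) =
      ENNReal.ofReal ((1 / r) ^ a * Real.Gamma a) := by
  have h := Real.integral_rpow_mul_exp_neg_mul_Ioi ha hr
  rw [← h, ofReal_integral_eq_lintegral_ofReal]
  · by_contra hn
    rw [integral_undef hn] at h
    have : 0 < (1 / r) ^ a * Real.Gamma a := mul_pos (by positivity) (Real.Gamma_pos_of_pos ha)
    linarith
  · refine (ae_restrict_iff' measurableSet_Ioi).2 (Filter.Eventually.of_forall fun t ht => ?_)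
    have : (0:ℝ) < t := ht
    simp only [Pi.zero_apply]; positivity

lemma aux_J (d : ℕ) (hd : 1 ≤ d) (s : ℝ) (hsd : s < d) :
    ∫⁻ w : EuclideanSpace ℝ (Fin d), ∫⁻ t, auxF s t (‖w‖ ^ 2) =
      ENNReal.ofReal ((2 * Real.pi) ^ ((d : ℝ) / 2) * (2 ^ (((d : ℝ) - s) / 2) * Real.Gamma (((d : ℝ) - s) / 2))) := by
  have : Nonempty (Fin d) := ⟨⟨0, hd⟩⟩
  have h1 : ∫⁻ w : EuclideanSpace ℝ (Fin d), ∫⁻ t, auxF s t (‖w‖ ^ 2) =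
     ∫⁻ w : EuclideanSpace ℝ (Fin d), ∫⁻ u in Set.Ioi (0:ℝ),
      ENNReal.ofReal (u ^ (-(s / 2) - 1) * Real.exp (-(u / 2)) * Real.exp (-(1 / (2 * u)) * ‖w‖ ^ 2)) := by
    apply lintegral_congr_ae
    have : ∀ᵐ w : EuclideanSpace ℝ (Fin d), w ≠ 0 := by
      simp [ae_iff]
    filter_upwards [this] with w hw
    exact aux_subst s _ (by positivity)
  rw [h1, lintegral_lintegral_swap (by fun_prop)]
  have h2 : ∀ u ∈ Set.Ioi (0:ℝ), ∫⁻ w : EuclideanSpace ℝ (Fin d), 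
      ENNReal.ofReal (u ^ (-(s / 2) - 1) * Real.exp (-(u / 2)) * Real.exp (-(1 / (2 * u)) * ‖w‖ ^ 2)) = 
      ENNReal.ofReal ((2 * Real.pi) ^ ((d : ℝ) / 2)) * ENNReal.ofReal (u ^ (((d : ℝ) - s) / 2 - 1) * Real.exp (-(1 / 2 * u))) := by
    intro u (hu : 0 < u)
    have h3 : ∀ w : EuclideanSpace ℝ (Fin d), ENNReal.ofReal (u ^ (-(s / 2) - 1) * Real.exp (-(u / 2)) * Real.exp (-(1 / (2 * u)) * ‖w‖ ^ 2)) =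
      ENNReal.ofReal (u ^ (-(s / 2) - 1) * Real.exp (-(u / 2))) * ENNReal.ofReal (Real.exp (-(1 / (2 * u)) * ‖w‖ ^ 2)) := 
      fun w => ENNReal.ofReal_mul (by positivity)
    simp_rw [h3]
    rw [lintegral_const_mul _ (by fun_prop), aux_gauss d u hu, ← ENNReal.ofReal_mul (by positivity), ← ENNReal.ofReal_mul (by positivity)]
    congr 1
    rw [show ((d : ℝ) - s) / 2 - 1 = (-(s / 2) - 1) + (d : ℝ) / 2 by ring, Real.rpow_add hu,
      show 1 / 2 * u = u / 2 by ring]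
    ring
  rw [setLIntegral_congr_fun measurableSet_Ioi h2, lintegral_const_mul _ (by fun_prop),
    aux_gamma _ _ (by linarith) (by norm_num), ← ENNReal.ofReal_mul (by positivity)]
  norm_num

lemma aux_radial (d : ℕ) (hd : 1 ≤ d) (s : ℝ) (hsd : s < d) :
    ∫⁻ y : EuclideanSpace ℝ (Fin (d + 1)), ENNReal.ofReal (‖y‖ ^ (-(s / 2)) * (Real.exp (-‖y‖) / ‖y‖)) =
      ENNReal.ofReal (2 * Real.pi ^ (((d : ℝ) + 1) / 2) / Real.Gamma (((d : ℝ) + 1) / 2) * Real.Gamma ((d : ℝ) - s / 2)) := by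
  have hd' : (1:ℝ) ≤ d := by exact_mod_cast hd
  have ha : 0 < (d : ℝ) - s / 2 := by linarith
  have h := integral_fun_norm_addHaar (volume : Measure (EuclideanSpace ℝ (Fin (d + 1))))
    (fun r => r ^ (-(s / 2)) * (Real.exp (-r) / r))
  have hG := Real.integral_rpow_mul_exp_neg_mul_Ioi ha one_pos
  have hi : ∫ y in Set.Ioi (0:ℝ), y ^ (Module.finrank ℝ (EuclideanSpace ℝ (Fin (d + 1))) - 1) • (y ^ (-(s / 2)) * (Real.exp (-y) / y))
      = Real.Gamma ((d : ℝ) - s / 2) := by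
    rw [div_one, Real.one_rpow, one_mul] at hG
    rw [← hG]
    refine setIntegral_congr_fun measurableSet_Ioi ?_
    intro y (hy : 0 < y)
    simp only [finrank_euclideanSpace_fin, add_tsub_cancel_right, smul_eq_mul, one_mul]
    rw [show (d : ℝ) - s / 2 - 1 = (d : ℝ) + (-(s / 2)) - 1 by ring, Real.rpow_sub hy, Real.rpow_add hy, Real.rpow_natCast, Real.rpow_one]
    ring
  have hv : (volume : Measure (EuclideanSpace ℝ (Fin (d + 1)))).real (Metric.ball 0 1) = 
      Real.pi ^ (((d : ℝ) + 1) / 2) / ((((d : ℝ) + 1) / 2) * Real.Gamma (((d : ℝ) + 1) / 2)) := by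
    rw [Measure.real, EuclideanSpace.volume_ball, ← Real.Gamma_add_one (by positivity)]
    simp only [ENNReal.ofReal_one, one_pow, one_mul, Fintype.card_fin]
    have h1 : √Real.pi ^ (d + 1) = Real.pi ^ (((d : ℝ) + 1) / 2) := by
      rw [Real.sqrt_eq_rpow, ← Real.rpow_natCast, ← Real.rpow_mul Real.pi_pos.le]
      congr 1; push_cast; ring
    have := Real.Gamma_pos_of_pos (s := ((d : ℝ) + 1) / 2 + 1) (by positivity)
    rw [ENNReal.toReal_ofReal (by push_cast; positivity), h1]
    push_cast; rfl
  rw [hi, hv] at h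
  have hGp := Real.Gamma_pos_of_pos ha
  have hGp2 := Real.Gamma_pos_of_pos (s := ((d : ℝ) + 1) / 2) (by positivity)
  have h' : ∫ y : EuclideanSpace ℝ (Fin (d + 1)), (‖y‖ ^ (-(s / 2)) * (Real.exp (-‖y‖) / ‖y‖)) = 2 * Real.pi ^ (((d : ℝ) + 1) / 2) / Real.Gamma (((d : ℝ) + 1) / 2) * Real.Gamma ((d : ℝ) - s / 2) := by
    rw [h]
    simp only [finrank_euclideanSpace_fin, smul_eq_mul, nsmul_eq_mul]
    push_cast
    field_simp
  rw [← h', ofReal_integral_eq_lintegral_ofReal]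
  · by_contra hn
    rw [integral_undef hn] at h'
    have : 0 < 2 * Real.pi ^ (((d : ℝ) + 1) / 2) / Real.Gamma (((d : ℝ) + 1) / 2) * Real.Gamma ((d : ℝ) - s / 2) := by positivity
    linarith
  · exact Filter.Eventually.of_forall fun _ => by simp only [Pi.zero_apply]; positivity

lemma aux_prob (d : ℕ) : IsProbabilityMeasure (sphereMeasure d) := by
  constructor
  simp only [sphereMeasure, Measure.smul_apply, Measure.restrict_apply_univ, smul_eq_mul]
  exact ENNReal.inv_mul_cancel (aux_pos d).ne' (aux_finite d).ne

lemma aux_ae (d : ℕ) : ∀ᵐ x ∂(sphereMeasure d), ‖x‖ = 1 := by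
  apply Measure.ae_smul_measure
  filter_upwards [ae_restrict_mem Metric.isClosed_sphere.measurableSet] with x hx
  simpa using hx

lemma aux_inv (d : ℕ)
    (e : EuclideanSpace ℝ (Fin (d + 1)) ≃ₗᵢ[ℝ] EuclideanSpace ℝ (Fin (d + 1))) :
    MeasurePreserving e (sphereMeasure d) (sphereMeasure d) := by
  unfold sphereMeasure
  apply MeasurePreserving.smul_measure
  have h := (e.toIsometryEquiv.measurePreserving_hausdorffMeasure (d : ℝ)).restrict_preimage
    (s := Metric.sphere (0 : EuclideanSpace ℝ (Fin (d + 1))) 1) Metric.isClosed_sphere.measurableSet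
  have h2 : (e.toIsometryEquiv ⁻¹' Metric.sphere (0 : EuclideanSpace ℝ (Fin (d + 1))) 1) =
      Metric.sphere (0 : EuclideanSpace ℝ (Fin (d + 1))) 1 := by
    ext y; simp
  rw [h2] at h
  exact h

lemma aux_trans {d : ℕ} {x y : EuclideanSpace ℝ (Fin (d + 1))} (hx : ‖x‖ = 1) (hy : ‖y‖ = 1) :
    ∃ e : EuclideanSpace ℝ (Fin (d + 1)) ≃ₗᵢ[ℝ] EuclideanSpace ℝ (Fin (d + 1)), e x = y :=
  ⟨_, Submodule.reflection_sub (hx.trans hy.symm)⟩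

noncomputable def auxC (d : ℕ) (s : ℝ) (x : EuclideanSpace ℝ (Fin (d + 1))) : ENNReal :=
  ∫⁻ y, ENNReal.ofReal (‖x - y‖ ^ (-s)) ∂(sphereMeasure d)

lemma auxC_const {d : ℕ} (s : ℝ) {x y : EuclideanSpace ℝ (Fin (d + 1))} (hx : ‖x‖ = 1)
    (hy : ‖y‖ = 1) : auxC d s x = auxC d s y := by
  obtain ⟨e, rfl⟩ := aux_trans hx hy
  unfold auxC
  rw [← (aux_inv d e).lintegral_comp
    (f := fun y => ENNReal.ofReal (‖e x - y‖ ^ (-s))) (by fun_prop)]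
  simp_rw [← map_sub, e.norm_map]

noncomputable def auxK {d : ℕ} (s : ℝ) (x y : EuclideanSpace ℝ (Fin (d + 1))) : ENNReal :=
  ENNReal.ofReal ((‖y‖ - inner ℝ x y) ^ (-(s / 2)) * (Real.exp (-‖y‖) / ‖y‖))

lemma auxK_const {d : ℕ} (s : ℝ) {x y : EuclideanSpace ℝ (Fin (d + 1))} (hx : ‖x‖ = 1)
    (hy : ‖y‖ = 1) : ∫⁻ z, auxK s x z = ∫⁻ z, auxK s y z := by
  obtain ⟨e, rfl⟩ := aux_trans hx hy
  unfold auxK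
  rw [← e.measurePreserving.lintegral_comp (f := fun z => ENNReal.ofReal
    ((‖z‖ - inner ℝ (e x) z) ^ (-(s / 2)) * (Real.exp (-‖z‖) / ‖z‖))) (by fun_prop)]
  simp_rw [e.inner_map_map, e.norm_map]

lemma auxK_int (d : ℕ) (hd : 1 ≤ d) (s : ℝ) (hsd : s < d)
    (x : EuclideanSpace ℝ (Fin (d + 1))) (hx : ‖x‖ = 1) :
    ∫⁻ z, auxK s x z = ENNReal.ofReal ((2 * Real.pi) ^ ((d : ℝ) / 2) *
      (2 ^ (((d : ℝ) - s) / 2) * Real.Gamma (((d : ℝ) - s) / 2))) := by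
  rw [auxK_const s hx (y := EuclideanSpace.single 0 1) (by simp), ← aux_J d hd s hsd,
    ← aux_split d (auxF s) (auxF_meas s)]
  apply lintegral_congr
  intro y
  have h : ‖y‖ = √(y 0 ^ 2 + ∑ i : Fin d, y i.succ ^ 2) := by
    rw [EuclideanSpace.norm_eq, Fin.sum_univ_succ]; simp
  unfold auxK auxF
  rw [← h, EuclideanSpace.inner_single_left]
  simp

lemma aux_kernel {d : ℕ} (s : ℝ) {x y : EuclideanSpace ℝ (Fin (d + 1))} (hx : ‖x‖ = 1)
    (hy : y ≠ 0) : auxK s x y = ENNReal.ofReal (2 ^ (s / 2)) *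
      ENNReal.ofReal (‖y‖ ^ (-(s / 2)) * (Real.exp (-‖y‖) / ‖y‖)) *
      ENNReal.ofReal (‖‖y‖⁻¹ • y - x‖ ^ (-s)) := by
  have hy' : 0 < ‖y‖ := norm_pos_iff.2 hy
  rw [← ENNReal.ofReal_mul (by positivity), ← ENNReal.ofReal_mul (by positivity)]
  unfold auxK
  congr 1
  have h1 : ‖y‖ - inner ℝ x y = ‖y‖ * (‖‖y‖⁻¹ • y - x‖ ^ 2 / 2) := by
    rw [norm_sub_sq_real, norm_smul, norm_inv, norm_norm, inv_mul_cancel₀ hy'.ne', hx,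
      real_inner_smul_left, real_inner_comm]
    field_simp
    ring
  have h2 : ‖‖y‖⁻¹ • y - x‖ ^ (-s) = (‖‖y‖⁻¹ • y - x‖ ^ 2) ^ (-(s / 2)) := by
    rw [← Real.rpow_natCast, ← Real.rpow_mul (norm_nonneg _)]
    congr 1; push_cast; ring
  rw [h1, h2, Real.mul_rpow hy'.le (by positivity), Real.div_rpow (by positivity) (by norm_num),
    Real.rpow_neg (by norm_num : (0:ℝ) ≤ 2)]
  field_simp

lemma auxC_eq (d : ℕ) (hd : 1 ≤ d) (s : ℝ) (hsd : s < d)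
    (x : EuclideanSpace ℝ (Fin (d + 1))) (hx : ‖x‖ = 1) :
    auxC d s x = ENNReal.ofReal (2 ^ ((d : ℝ) - 1 - s) * Real.Gamma (((d : ℝ) + 1) / 2) *
        Real.Gamma (((d : ℝ) - s) / 2) /
          (Real.sqrt Real.pi * Real.Gamma ((d : ℝ) - s / 2))) := by
  have hd' : (1:ℝ) ≤ d := by exact_mod_cast hd
  have := aux_prob d
  have g1 := Real.Gamma_pos_of_pos (s := ((d : ℝ) + 1) / 2) (by positivity)
  have g2 := Real.Gamma_pos_of_pos (s := ((d : ℝ) - s) / 2) (by linarith)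
  have g3 := Real.Gamma_pos_of_pos (s := (d : ℝ) - s / 2) (by linarith)
  set A := 2 * Real.pi ^ (((d : ℝ) + 1) / 2) / Real.Gamma (((d : ℝ) + 1) / 2) *
    Real.Gamma ((d : ℝ) - s / 2) with hA
  set J := (2 * Real.pi) ^ ((d : ℝ) / 2) *
      (2 ^ (((d : ℝ) - s) / 2) * Real.Gamma (((d : ℝ) - s) / 2)) with hJ
  have e1 : ∫⁻ z, ∫⁻ y, auxK s z y ∂volume ∂(sphereMeasure d) = ENNReal.ofReal J := by
    have : ∫⁻ z, ∫⁻ y, auxK s z y ∂volume ∂(sphereMeasure d) =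
        ∫⁻ z, ENNReal.ofReal J ∂(sphereMeasure d) := by
      apply lintegral_congr_ae
      filter_upwards [aux_ae d] with z hz
      exact auxK_int d hd s hsd z hz
    rw [this]; simp
  have e2 : ∫⁻ z, ∫⁻ y, auxK s z y ∂volume ∂(sphereMeasure d) =
      ENNReal.ofReal (2 ^ (s / 2)) * ENNReal.ofReal A * auxC d s x := by
    rw [lintegral_lintegral_swap (by unfold auxK; fun_prop)]
    rw [hA, ← aux_radial d hd s hsd, ← lintegral_const_mul _ (by fun_prop),
      ← lintegral_mul_const _ (by fun_prop)]
    apply lintegral_congr_ae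
    have : ∀ᵐ w : EuclideanSpace ℝ (Fin (d + 1)), w ≠ 0 := by
      simp [ae_iff]
    filter_upwards [this] with y hy
    have hy' : ‖(‖y‖⁻¹ • y)‖ = 1 := by
      rw [norm_smul, norm_inv, norm_norm, inv_mul_cancel₀ (norm_ne_zero_iff.2 hy)]
    rw [auxC_const s hx hy', auxC, ← lintegral_const_mul _ (by fun_prop)]
    apply lintegral_congr_ae
    filter_upwards [aux_ae d] with z hz
    exact aux_kernel s hz hy
  rw [e1, ← ENNReal.ofReal_mul (by positivity)] at e2
  have hB : 0 < 2 ^ (s / 2) * A := by positivity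
  have e3 : auxC d s x = ENNReal.ofReal (J / (2 ^ (s / 2) * A)) := by
    rw [ENNReal.ofReal_div_of_pos hB, e2, mul_comm]
    rw [ENNReal.mul_div_cancel_right (by simpa using hB) ENNReal.ofReal_ne_top]
  rw [e3]
  congr 1
  rw [hJ, hA, Real.sqrt_eq_rpow, Real.mul_rpow (by norm_num) Real.pi_pos.le]
  have p1 : Real.pi ^ (((d : ℝ) + 1) / 2) = Real.pi ^ ((d : ℝ) / 2) * Real.pi ^ ((1 : ℝ) / 2) := by
    rw [← Real.rpow_add Real.pi_pos]; congr 1; ring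
  have p2 : (2:ℝ) ^ ((d : ℝ) / 2) * 2 ^ (((d : ℝ) - s) / 2) =
      2 ^ ((d : ℝ) - 1 - s) * 2 ^ (s / 2) * 2 := by
    rw [← Real.rpow_add two_pos, ← Real.rpow_add two_pos, ← Real.rpow_add_one two_ne_zero]
    congr 1; ring
  rw [p1, div_eq_div_iff (by positivity) (by positivity)]
  generalize Real.Gamma ((d : ℝ) - s / 2) = c at *
  generalize Real.Gamma (((d : ℝ) - s) / 2) = b at *
  generalize Real.Gamma (((d : ℝ) + 1) / 2) = a at *
  have hp : 0 < Real.pi ^ ((d : ℝ) / 2) := by positivity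
  have hq : 0 < Real.pi ^ ((1 : ℝ) / 2) := by positivity
  generalize Real.pi ^ ((d : ℝ) / 2) = p at *
  generalize Real.pi ^ ((1 : ℝ) / 2) = q at *
  have h3 : 2 ^ ((d : ℝ) - 1 - s) * a * b * (2 ^ (s / 2) * (2 * (p * q) / a * c)) =
      2 ^ ((d : ℝ) - 1 - s) * 2 ^ (s / 2) * 2 * (b * p * q * c) := by
    generalize (2 : ℝ) ^ ((d : ℝ) - 1 - s) = k
    generalize (2 : ℝ) ^ (s / 2) = l
    field_simp
  rw [h3, ← p2]
  ring

theorem riesz_energy_of_uniform_measure_on_sphere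
    (d : ℕ) (hd : 1 ≤ d) (s : ℝ) (hs0 : 0 < s) (hsd : s < d) :
    ∫ x, ∫ y, ‖x - y‖ ^ (-s) ∂(sphereMeasure d) ∂(sphereMeasure d) =
      2 ^ ((d : ℝ) - 1 - s) * Real.Gamma (((d : ℝ) + 1) / 2) *
        Real.Gamma (((d : ℝ) - s) / 2) /
          (Real.sqrt Real.pi * Real.Gamma ((d : ℝ) - s / 2)) := by
  have := aux_prob d
  set R := 2 ^ ((d : ℝ) - 1 - s) * Real.Gamma (((d : ℝ) + 1) / 2) *
        Real.Gamma (((d : ℝ) - s) / 2) /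
          (Real.sqrt Real.pi * Real.Gamma ((d : ℝ) - s / 2)) with hR
  have hd' : (1:ℝ) ≤ d := by exact_mod_cast hd
  have hR0 : 0 ≤ R := by
    have g1 := Real.Gamma_pos_of_pos (s := ((d : ℝ) + 1) / 2) (by positivity)
    have g2 := Real.Gamma_pos_of_pos (s := ((d : ℝ) - s) / 2) (by linarith)
    have g3 := Real.Gamma_pos_of_pos (s := (d : ℝ) - s / 2) (by linarith)
    positivity
  have h : ∫ x, ∫ y, ‖x - y‖ ^ (-s) ∂(sphereMeasure d) ∂(sphereMeasure d) =
      ∫ x, R ∂(sphereMeasure d) := by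
    apply integral_congr_ae
    filter_upwards [aux_ae d] with x hx
    rw [integral_eq_lintegral_of_nonneg_ae (Filter.Eventually.of_forall fun y => by
      simp only [Pi.zero_apply]; positivity) (by
        apply Measurable.aestronglyMeasurable; fun_prop)]
    change (auxC d s x).toReal = R
    rw [auxC_eq d hd s hsd x hx, ENNReal.toReal_ofReal hR0]
  rw [h]
  simp
end

section
/- Let d ≥ 1 and 0 < s < d. Then the minimal N-point Riesz s-energy of the sphere satisfies lim_{N→∞} ℰ_s(S^d; N)/N² = W_s(S^d), where W_s(S^d) = ∫_{S^d} ∫_{S^d} ‖x - y‖^{-s} dσ_d(x) dσ_d(y). -/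
open MeasureTheory Filter

/-- The minimal `N`-point Riesz `s`-energy `ℰ_s(S^d; N)` of the unit sphere `S^d`:
the infimum over all configurations of `N` distinct points on `S^d` of
`Σ_{i ≠ j} ‖x_i - x_j‖^{-s}`. -/
noncomputable def minRieszEnergy (d : ℕ) (s : ℝ) (N : ℕ) : ℝ :=
  sInf {E : ℝ | ∃ x : Fin N → EuclideanSpace ℝ (Fin (d + 1)),
    Function.Injective x ∧ (∀ i, ‖x i‖ = 1) ∧
    E = ∑ i : Fin N, ∑ j : Fin N, if i = j then 0 else (‖x i - x j‖ ^ s)⁻¹}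

section RieszGeometry

open Module Metric Submodule
open scoped RealInnerProductSpace ENNReal NNReal

variable {E : Type*} [NormedAddCommGroup E] [InnerProductSpace ℝ E]

lemma riesz_norm_normalize_sub_le (u v : E) (hu : 1 ≤ ‖u‖) (hv : 1 ≤ ‖v‖) :
    ‖‖u‖⁻¹ • u - ‖v‖⁻¹ • v‖ ≤ 2 * ‖u - v‖ := by
  have hu0 : 0 < ‖u‖ := by linarith
  have hv0 : 0 < ‖v‖ := by linarith
  have h1 : ‖u‖⁻¹ • u - ‖v‖⁻¹ • v = ‖u‖⁻¹ • (u - v) + (‖u‖⁻¹ - ‖v‖⁻¹) • v := by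
    rw [smul_sub, sub_smul]; abel
  have hui : ‖u‖⁻¹ ≤ 1 := inv_le_one_of_one_le₀ hu
  have h2 : ‖‖u‖⁻¹ • (u - v)‖ ≤ ‖u - v‖ := by
    rw [norm_smul, norm_inv, norm_norm]
    nlinarith [norm_nonneg (u - v)]
  have h3 : ‖(‖u‖⁻¹ - ‖v‖⁻¹) • v‖ ≤ ‖u - v‖ := by
    have : ‖u‖⁻¹ - ‖v‖⁻¹ = ‖u‖⁻¹ * (‖v‖ - ‖u‖) * ‖v‖⁻¹ := by field_simp
    rw [this, norm_smul, norm_mul, norm_mul, norm_inv, norm_inv, norm_norm, norm_norm,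
      mul_assoc, inv_mul_cancel₀ hv0.ne', mul_one]
    have := abs_norm_sub_norm_le v u
    rw [norm_sub_rev] at this
    rw [Real.norm_eq_abs]
    nlinarith [abs_nonneg (‖v‖ - ‖u‖), inv_nonneg.2 hu0.le]
  rw [h1]
  linarith [norm_add_le (‖u‖⁻¹ • (u - v)) ((‖u‖⁻¹ - ‖v‖⁻¹) • v)]

/-- central parametrisation of the half sphere. -/
noncomputable def rieszPhi (e : E) (y : (ℝ ∙ e)ᗮ) : E := ‖e + (y : E)‖⁻¹ • (e + (y : E))

lemma riesz_inner_orth (e : E) (y : (ℝ ∙ e)ᗮ) : ⟪e, (y : E)⟫ = 0 :=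
  (mem_orthogonal_singleton_iff_inner_right).1 y.2

lemma riesz_one_le_norm (e : E) (he : ‖e‖ = 1) (y : (ℝ ∙ e)ᗮ) : 1 ≤ ‖e + (y : E)‖ := by
  have := norm_add_sq_eq_norm_sq_add_norm_sq_of_inner_eq_zero e (y : E) (riesz_inner_orth e y)
  rw [he] at this
  nlinarith [norm_nonneg (e + (y : E)), norm_nonneg (y : E)]

lemma rieszPhi_lipschitz (e : E) (he : ‖e‖ = 1) : LipschitzWith 2 (rieszPhi e) := by
  refine LipschitzWith.of_dist_le_mul fun y z => ?_
  rw [dist_eq_norm, dist_eq_norm]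
  refine (riesz_norm_normalize_sub_le _ _ (riesz_one_le_norm e he y)
    (riesz_one_le_norm e he z)).trans (le_of_eq ?_)
  simp

lemma riesz_cap_subset (e : E) (he : ‖e‖ = 1) (r : ℝ) (hr : r ≤ 1) :
    sphere (0 : E) 1 ∩ closedBall e r ⊆ rieszPhi e '' closedBall 0 (2 * r) := by
  rintro z ⟨hz, hzr⟩
  rw [mem_sphere_zero_iff_norm] at hz
  rw [mem_closedBall, dist_eq_norm] at hzr
  have h1 := norm_sub_sq_real z e
  rw [hz, he, real_inner_comm] at h1
  set a := ⟪e, z⟫ with ha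
  have hr0 : 0 ≤ r := (norm_nonneg _).trans hzr
  have h2 : ‖z - e‖ ^ 2 ≤ r ^ 2 := by gcongr
  have ha1 : 1 / 2 ≤ a := by nlinarith
  have ha0 : 0 < a := by linarith
  have hsub : ‖z - a • e‖ ^ 2 = 1 - a ^ 2 := by
    rw [norm_sub_sq_real, inner_smul_right, real_inner_comm, ← ha, norm_smul, hz, he,
      Real.norm_eq_abs, mul_one, sq_abs]; ring
  have hle : a ≤ 1 := by
    nlinarith [sq_nonneg ‖z - e‖]
  have hn : ‖z - a • e‖ ≤ r := by
    apply le_of_sq_le_sq _ hr0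
    nlinarith
  have hy : a⁻¹ • z - e ∈ (ℝ ∙ e)ᗮ := by
    rw [mem_orthogonal_singleton_iff_inner_right, inner_sub_right, inner_smul_right, ← ha,
      real_inner_self_eq_norm_sq, he, inv_mul_cancel₀ ha0.ne']; norm_num
  refine ⟨⟨_, hy⟩, ?_, ?_⟩
  · rw [mem_closedBall, dist_zero_right, Submodule.coe_norm]
    have : a⁻¹ • z - e = a⁻¹ • (z - a • e) := by
      rw [smul_sub, smul_smul, inv_mul_cancel₀ ha0.ne', one_smul]
    simp only [this]
    rw [norm_smul, norm_inv, Real.norm_eq_abs, abs_of_pos ha0]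
    have : a⁻¹ ≤ 2 := by rw [inv_le_comm₀ ha0 two_pos]; linarith
    exact mul_le_mul this hn (norm_nonneg _) two_pos.le
  · simp only [rieszPhi, add_sub_cancel]
    rw [norm_smul, hz, norm_inv, Real.norm_eq_abs, abs_of_pos ha0, mul_one, inv_inv, smul_smul,
      mul_inv_cancel₀ ha0.ne', one_smul]

variable [MeasurableSpace E] [BorelSpace E] [FiniteDimensional ℝ E]
  {d : ℕ}

lemma riesz_orth_haar (hE : finrank ℝ E = d + 1)
    (e : E) (he : ‖e‖ = 1) :
    finrank ℝ (ℝ ∙ e)ᗮ = d ∧ (μH[(d : ℝ)] : Measure (ℝ ∙ e)ᗮ).IsAddHaarMeasure := by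
  have : Fact (finrank ℝ E = d + 1) := ⟨hE⟩
  have h : finrank ℝ (ℝ ∙ e)ᗮ = d :=
    finrank_orthogonal_span_singleton (by rintro rfl; simp at he)
  refine ⟨h, ?_⟩
  have := isAddHaarMeasure_hausdorffMeasure (E := (ℝ ∙ e)ᗮ)
  rwa [h] at this

lemma riesz_cap_measure (hE : finrank ℝ E = d + 1)
    (e : E) (he : ‖e‖ = 1) : ∃ C : ℝ≥0∞, C ≠ ∞ ∧ ∀ r : ℝ, 0 ≤ r → r ≤ 1 →
    μH[(d : ℝ)] (sphere (0 : E) 1 ∩ closedBall e r) ≤ C * ENNReal.ofReal (r ^ d) := by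
  obtain ⟨h, hh⟩ := riesz_orth_haar hE e he
  refine ⟨(2 : ℝ≥0∞) ^ d * (ENNReal.ofReal (2 ^ d) *
    (μH[(d : ℝ)] : Measure (ℝ ∙ e)ᗮ) (closedBall 0 1)), ?_, fun r hr0 hr => ?_⟩
  · refine ENNReal.mul_ne_top (by simp) (ENNReal.mul_ne_top (by simp) ?_)
    exact (isCompact_closedBall _ _).measure_ne_top
  · refine (measure_mono (riesz_cap_subset e he r hr)).trans ?_
    refine ((rieszPhi_lipschitz e he).hausdorffMeasure_image_le (Nat.cast_nonneg d) _).trans ?_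
    rw [Measure.addHaar_closedBall' _ _ (by positivity), h, mul_pow,
      ENNReal.ofReal_mul (by positivity)]
    apply le_of_eq
    simp only [ENNReal.rpow_natCast]
    push_cast
    ring

lemma riesz_sphere_lt_top (hE : finrank ℝ E = d + 1)
    : μH[(d : ℝ)] (sphere (0 : E) 1) < ∞ := by
  refine (isCompact_sphere 0 1).measure_lt_top_of_nhdsWithin fun x hx => ?_
  obtain ⟨C, hC, h⟩ := riesz_cap_measure hE x (by simpa using hx)
  refine ⟨sphere (0 : E) 1 ∩ closedBall x 1, ?_, ?_⟩
  · exact inter_mem self_mem_nhdsWithin (nhdsWithin_le_nhds (closedBall_mem_nhds x one_pos))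
  · refine (h 1 zero_le_one le_rfl).trans_lt ?_
    simpa using hC.lt_top

lemma riesz_sphere_pos (hE : finrank ℝ E = d + 1)
    (e : E) (he : ‖e‖ = 1) : 0 < μH[(d : ℝ)] (sphere (0 : E) 1) := by
  obtain ⟨h, hh⟩ := riesz_orth_haar hE e he
  have h1 := (lipschitzWith_orthogonalProjectionOnto (ℝ ∙ e)ᗮ).hausdorffMeasure_image_le
    (Nat.cast_nonneg d) (sphere (0 : E) 1)
  have h2 : closedBall 0 1 ⊆ orthogonalProjectionOnto (ℝ ∙ e)ᗮ '' (sphere (0 : E) 1) := by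
    intro y hy
    rw [mem_closedBall, dist_zero_right] at hy
    refine ⟨Real.sqrt (1 - ‖y‖ ^ 2) • e + y, ?_, ?_⟩
    · rw [mem_sphere_zero_iff_norm]
      have := norm_add_sq_eq_norm_sq_add_norm_sq_of_inner_eq_zero (Real.sqrt (1 - ‖y‖ ^ 2) • e)
        (y : E) (by rw [inner_smul_left, riesz_inner_orth]; simp)
      rw [norm_smul, he, mul_one, Real.norm_eq_abs, abs_of_nonneg (Real.sqrt_nonneg _),
        Real.mul_self_sqrt (by nlinarith [norm_nonneg y])] at this
      rw [← Submodule.coe_norm] at this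
      have h4 : ‖Real.sqrt (1 - ‖y‖ ^ 2) • e + (y : E)‖ ^ 2 = 1 := by rw [sq, this]; ring
      nlinarith [norm_nonneg (Real.sqrt (1 - ‖y‖ ^ 2) • e + (y : E))]
    · rw [map_add, orthogonalProjectionOnto_mem_subspace_eq_self, map_smul,
        orthogonalProjectionOnto_orthogonal_apply_eq_zero (mem_span_singleton_self e)]
      simp
  have h3 : 0 < (μH[(d : ℝ)] : Measure (ℝ ∙ e)ᗮ) (closedBall 0 1) :=
    measure_closedBall_pos _ _ one_pos
  have := (h3.trans_le (measure_mono h2)).trans_le h1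
  simpa using this

end RieszGeometry

section RieszMeasure

open Module Metric Submodule
open scoped RealInnerProductSpace ENNReal NNReal

lemma riesz_finrank (d : ℕ) : finrank ℝ (EuclideanSpace ℝ (Fin (d + 1))) = d + 1 := by simp

lemma riesz_exists_unit (d : ℕ) : ∃ e : EuclideanSpace ℝ (Fin (d + 1)), ‖e‖ = 1 :=
  ⟨EuclideanSpace.single 0 1, by simp⟩

lemma riesz_H_ne_zero (d : ℕ) :
    μH[(d : ℝ)] (sphere (0 : EuclideanSpace ℝ (Fin (d + 1))) 1) ≠ 0 := by
  obtain ⟨e, he⟩ := riesz_exists_unit d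
  exact (riesz_sphere_pos (riesz_finrank d) e he).ne'

lemma riesz_H_ne_top (d : ℕ) :
    μH[(d : ℝ)] (sphere (0 : EuclideanSpace ℝ (Fin (d + 1))) 1) ≠ ∞ :=
  (riesz_sphere_lt_top (riesz_finrank d)).ne

instance riesz_isProb (d : ℕ) : IsProbabilityMeasure (sphereMeasure d) := by
  constructor
  rw [sphereMeasure, Measure.smul_apply, Measure.restrict_apply_univ, smul_eq_mul]
  exact ENNReal.inv_mul_cancel (riesz_H_ne_zero d) (riesz_H_ne_top d)

lemma riesz_ae_norm (d : ℕ) : ∀ᵐ y ∂(sphereMeasure d), ‖y‖ = 1 := by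
  apply Measure.ae_smul_measure
  filter_upwards [ae_restrict_mem isClosed_sphere.measurableSet] with y hy
  simpa using hy

lemma riesz_singleton (d : ℕ) (hd : 1 ≤ d) (x : EuclideanSpace ℝ (Fin (d + 1))) :
    sphereMeasure d {x} = 0 := by
  have : NullSingletonClass (μH[(d : ℝ)] : Measure (EuclideanSpace ℝ (Fin (d + 1)))) :=
    Measure.nullSingletonClass_hausdorff _ (by exact_mod_cast hd)
  rw [sphereMeasure, Measure.smul_apply,
    nonpos_iff_eq_zero.1 ((Measure.restrict_apply_le _ _).trans (measure_singleton x).le), smul_zero]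

lemma riesz_exists_isometry (d : ℕ) (x x' : EuclideanSpace ℝ (Fin (d + 1))) (h : ‖x‖ = ‖x'‖) :
    ∃ R : EuclideanSpace ℝ (Fin (d + 1)) ≃ₗᵢ[ℝ] EuclideanSpace ℝ (Fin (d + 1)),
      R x = x' ∧ MeasurePreserving R (sphereMeasure d) (sphereMeasure d) := by
  refine ⟨reflection (ℝ ∙ (x - x'))ᗮ, reflection_sub h, ?_⟩
  set R := reflection (ℝ ∙ (x - x'))ᗮ
  have h1 := R.toIsometryEquiv.measurePreserving_hausdorffMeasure (d : ℝ)
  have h2 := h1.restrict_preimage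
    (s := sphere (0 : EuclideanSpace ℝ (Fin (d + 1))) 1) isClosed_sphere.measurableSet
  have h3 : R.toIsometryEquiv ⁻¹' sphere (0 : EuclideanSpace ℝ (Fin (d + 1))) 1 = sphere 0 1 := by
    ext y; simp
  rw [h3] at h2
  exact h2.smul_measure _

/-- Zonal integrals do not depend on the pole. -/
lemma riesz_invariance (d : ℕ) (x x' : EuclideanSpace ℝ (Fin (d + 1))) (h : ‖x‖ = ‖x'‖)
    (g : ℝ → ℝ) : ∫ y, g ‖x - y‖ ∂(sphereMeasure d) = ∫ y, g ‖x' - y‖ ∂(sphereMeasure d) := by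
  obtain ⟨R, hR, hm⟩ := riesz_exists_isometry d x x' h
  symm
  rw [← hm.integral_comp R.toHomeomorph.measurableEmbedding]
  refine integral_congr_ae (Eventually.of_forall fun y => ?_)
  simp only [← hR, ← map_sub, R.norm_map]

lemma riesz_invariance_inner (d : ℕ) (x x' : EuclideanSpace ℝ (Fin (d + 1))) (h : ‖x‖ = ‖x'‖)
    (g : ℝ → ℝ) : ∫ y, g ⟪x, y⟫ ∂(sphereMeasure d) = ∫ y, g ⟪x', y⟫ ∂(sphereMeasure d) := by
  obtain ⟨R, hR, hm⟩ := riesz_exists_isometry d x x' h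
  symm
  rw [← hm.integral_comp R.toHomeomorph.measurableEmbedding]
  refine integral_congr_ae (Eventually.of_forall fun y => ?_)
  simp only [← hR, R.inner_map_map]

lemma riesz_sigma_ball (d : ℕ) (x : EuclideanSpace ℝ (Fin (d + 1))) (hx : ‖x‖ = 1) :
    ∃ C : ℝ≥0∞, C ≠ ∞ ∧ ∀ r : ℝ, 0 ≤ r → r ≤ 1 →
    sphereMeasure d (closedBall x r) ≤ C * ENNReal.ofReal (r ^ d) := by
  obtain ⟨C, hC, h⟩ := riesz_cap_measure (riesz_finrank d) x hx
  refine ⟨(μH[(d : ℝ)] (sphere (0 : EuclideanSpace ℝ (Fin (d + 1))) 1))⁻¹ * C,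
    ENNReal.mul_ne_top (ENNReal.inv_ne_top.2 (riesz_H_ne_zero d)) hC, fun r h0 h1 => ?_⟩
  rw [sphereMeasure, Measure.smul_apply, smul_eq_mul,
    Measure.restrict_apply isClosed_closedBall.measurableSet, Set.inter_comm, mul_assoc]
  gcongr
  exact h r h0 h1

lemma riesz_integrable (d : ℕ) (s : ℝ) (hs0 : 0 < s) (hsd : s < d)
    (x : EuclideanSpace ℝ (Fin (d + 1))) (hx : ‖x‖ = 1) :
    Integrable (fun y => ‖x - y‖ ^ (-s)) (sphereMeasure d) := by
  have hmeas : Measurable (fun y : EuclideanSpace ℝ (Fin (d + 1)) => ‖x - y‖ ^ (-s)) := by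
    fun_prop
  have hnn : ∀ y : EuclideanSpace ℝ (Fin (d + 1)), 0 ≤ ‖x - y‖ ^ (-s) := fun y => by positivity
  refine ⟨hmeas.aestronglyMeasurable, ?_⟩
  rw [hasFiniteIntegral_iff_ofReal (Eventually.of_forall hnn),
    lintegral_eq_lintegral_meas_le _ (Eventually.of_forall hnn) hmeas.aemeasurable]
  obtain ⟨C, hC, h⟩ := riesz_sigma_ball d x hx
  rw [← Set.Ioc_union_Ioi_eq_Ioi (zero_le_one' ℝ)]
  refine (lintegral_union_le _ _ _).trans_lt (ENNReal.add_lt_top.2 ⟨?_, ?_⟩)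
  · refine (lintegral_mono (g := fun _ => 1) fun t => prob_le_one).trans_lt ?_
    simp
  · have key : ∀ t ∈ Set.Ioi (1 : ℝ), sphereMeasure d {a | t ≤ ‖x - a‖ ^ (-s)} ≤
        C * ENNReal.ofReal (t ^ (-(d : ℝ) / s)) := by
      intro t ht
      have ht : 1 < t := ht
      have ht0 : 0 < t := by linarith
      have hsub : {a | t ≤ ‖x - a‖ ^ (-s)} ⊆ closedBall x (t ^ (-1 / s)) := by
        intro a ha
        have ha : t ≤ ‖x - a‖ ^ (-s) := ha
        rw [mem_closedBall, dist_comm, dist_eq_norm]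
        have h1 := Real.rpow_le_rpow_of_nonpos ht0 ha
          (z := -1 / s) (by rw [neg_div]; simp; positivity)
        rwa [← Real.rpow_mul (norm_nonneg _), show -s * (-1 / s) = 1 by field_simp,
          Real.rpow_one] at h1
      refine (measure_mono hsub).trans ((h _ (by positivity) ?_).trans (le_of_eq ?_))
      · apply Real.rpow_le_one_of_one_le_of_nonpos ht.le
        rw [neg_div]; simp; positivity
      · rw [← Real.rpow_natCast, ← Real.rpow_mul ht0.le]
        congr 3; ring
    refine (setLIntegral_mono_ae' measurableSet_Ioi (Eventually.of_forall key)).trans_lt ?_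
    rw [lintegral_const_mul' _ _ hC]
    refine ENNReal.mul_lt_top hC.lt_top ?_
    have hlt : -(d : ℝ) / s < -1 := by
      rw [neg_div, neg_lt_neg_iff, lt_div_iff₀ hs0]; linarith
    have hi := integrableOn_Ioi_rpow_of_lt hlt one_pos
    exact (hasFiniteIntegral_iff_ofReal (by
      filter_upwards [ae_restrict_mem measurableSet_Ioi] with t ht
      have ht : 1 < t := ht
      positivity)).1 hi.2

end RieszMeasure

section RieszLower

open Module Metric Submodule
open scoped RealInnerProductSpace ENNReal NNReal

lemma riesz_inner_pow (d k : ℕ) (x y : EuclideanSpace ℝ (Fin (d + 1))) :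
    ⟪x, y⟫ ^ k = ∑ f : Fin k → Fin (d + 1), (∏ i, x (f i)) * ∏ i, y (f i) := by
  rw [PiLp.inner_apply, Fintype.sum_pow]
  refine Finset.sum_congr rfl fun f _ => ?_
  rw [← Finset.prod_mul_distrib]
  refine Finset.prod_congr rfl fun i _ => ?_
  simp [mul_comm]

lemma riesz_mono_integrable (d k : ℕ) (f : Fin k → Fin (d + 1)) :
    Integrable (fun y : EuclideanSpace ℝ (Fin (d + 1)) => ∏ i, y (f i)) (sphereMeasure d) := by
  refine Integrable.of_bound (C := 1) ?_ ?_
  · exact Continuous.aestronglyMeasurable (by fun_prop)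
  · filter_upwards [riesz_ae_norm d] with y hy
    rw [norm_prod]
    refine Finset.prod_le_one (fun i _ => norm_nonneg _) fun i _ => ?_
    exact (PiLp.norm_apply_le y (f i)).trans hy.le

lemma riesz_moment (d k N : ℕ) (e : EuclideanSpace ℝ (Fin (d + 1))) (he : ‖e‖ = 1)
    (x : Fin N → EuclideanSpace ℝ (Fin (d + 1))) (hx : ∀ i, ‖x i‖ = 1) :
    (N : ℝ) ^ 2 * ∫ y, ⟪e, y⟫ ^ k ∂(sphereMeasure d) ≤ ∑ i, ∑ j, ⟪x i, x j⟫ ^ k := by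
  set c := ∫ y, ⟪e, y⟫ ^ k ∂(sphereMeasure d) with hc
  set B : (Fin k → Fin (d + 1)) → ℝ := fun f => ∫ y, ∏ i, y (f i) ∂(sphereMeasure d) with hB
  set A : (Fin k → Fin (d + 1)) → ℝ := fun f => ∑ l, ∏ i, (x l) (f i) with hA
  have h1 : ∀ z : EuclideanSpace ℝ (Fin (d + 1)), ‖z‖ = 1 → ∑ f, (∏ i, z (f i)) * B f = c := by
    intro z hz
    rw [hc, riesz_invariance_inner d e z (by rw [he, hz]) (fun u => u ^ k)]
    simp only [riesz_inner_pow]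
    rw [integral_finsetSum _ fun f _ => (riesz_mono_integrable d k f).const_mul _]
    simp only [integral_const_mul, hB]
  have h2 : ∑ f, B f * B f = c := by
    have : ∫ z : EuclideanSpace ℝ (Fin (d + 1)), ∑ f, (∏ i, z (f i)) * B f ∂(sphereMeasure d)
        = ∫ z, c ∂(sphereMeasure d) := by
      refine integral_congr_ae ?_
      filter_upwards [riesz_ae_norm d] with z hz using h1 z hz
    rw [integral_finsetSum _ fun f _ => (riesz_mono_integrable d k f).mul_const _] at this
    simpa [integral_mul_const] using this
  have h3 : ∑ f, A f * B f = N * c := by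
    simp only [hA, Finset.sum_mul]
    rw [Finset.sum_comm]
    rw [Finset.sum_congr rfl fun l _ => h1 (x l) (hx l)]
    simp
  have h4 : ∑ f, A f * A f = ∑ i, ∑ j, ⟪x i, x j⟫ ^ k := by
    simp only [hA, Finset.sum_mul_sum, riesz_inner_pow]
    rw [Finset.sum_comm]
    refine Finset.sum_congr rfl fun i _ => ?_
    rw [Finset.sum_comm]
  have h5 : 0 ≤ ∑ f, (A f - N * B f) ^ 2 := Finset.sum_nonneg fun f _ => sq_nonneg _
  have h6 : ∑ f, (A f - N * B f) ^ 2 = ∑ f, A f * A f - 2 * N * ∑ f, A f * B f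
      + N ^ 2 * ∑ f, B f * B f := by
    rw [Finset.mul_sum, Finset.mul_sum, ← Finset.sum_sub_distrib, ← Finset.sum_add_distrib]
    exact Finset.sum_congr rfl fun f _ => by ring
  rw [h6, h2, h3, h4] at h5
  nlinarith

lemma riesz_choose_nonneg (a : ℝ) (ha : 0 < a) (n : ℕ) : 0 ≤ Ring.choose (a + n - 1) n := by
  rw [← Ring.multichoose_eq]
  have h := Ring.factorial_nsmul_multichoose_eq_ascPochhammer a n
  have h2 : 0 < (ascPochhammer ℕ n).smeval a := by
    rw [Polynomial.ascPochhammer_smeval_eq_eval]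
    exact ascPochhammer_pos n a ha
  rw [← h, nsmul_eq_mul] at h2
  exact (pos_of_mul_pos_right h2 (by positivity)).le

lemma riesz_series (a ε : ℝ) (ha : 0 < a) (hε : 0 < ε) : ∃ b : ℕ → ℝ, (∀ k, 0 ≤ b k) ∧
    ∀ u : ℝ, |u| ≤ 1 → HasSum (fun k => b k * u ^ k) ((2 + ε - 2 * u) ^ (-a)) := by
  refine ⟨fun k => (2 + ε) ^ (-a) * (Ring.choose (a + k - 1) k * (2 / (2 + ε)) ^ k), ?_, ?_⟩
  · intro k
    have := riesz_choose_nonneg a ha k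
    positivity
  · intro u hu
    have hlt : |2 / (2 + ε) * u| < 1 := by
      rw [abs_mul, abs_of_pos (by positivity)]
      have : 2 / (2 + ε) < 1 := by rw [div_lt_one (by positivity)]; linarith
      nlinarith [abs_nonneg u, show (0:ℝ) < 2 / (2 + ε) by positivity]
    have h := (Real.one_div_one_sub_rpow_hasFPowerSeriesOnBall_zero a).hasSum
      (y := 2 / (2 + ε) * u) (by
        rw [mem_eball_zero_iff, ← ofReal_norm, Real.norm_eq_abs, ← ENNReal.ofReal_one]
        exact (ENNReal.ofReal_lt_ofReal_iff one_pos).2 hlt)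
    have h2 := h.mul_left ((2 + ε) ^ (-a))
    have e1 : (fun i : ℕ => (2 + ε) ^ (-a) *
        (FormalMultilinearSeries.ofScalars ℝ (fun n : ℕ => Ring.choose (a + n - 1) n) i)
          fun _ => 2 / (2 + ε) * u) =
        fun k : ℕ => (2 + ε) ^ (-a) * (Ring.choose (a + k - 1) k * (2 / (2 + ε)) ^ k) * u ^ k := by
      funext k
      rw [FormalMultilinearSeries.ofScalars_apply_eq, smul_eq_mul, mul_pow]
      ring
    have e2 : (2 + ε) ^ (-a) * (1 / (1 - (0 + 2 / (2 + ε) * u)) ^ a) =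
        (2 + ε - 2 * u) ^ (-a) := by
      have hp : 0 < 1 - 2 / (2 + ε) * u := by linarith [(abs_lt.1 hlt).2]
      rw [zero_add, one_div, ← Real.rpow_neg hp.le, ← Real.mul_rpow (by positivity) hp.le]
      congr 1
      field_simp
    rw [← e2]
    exact e1 ▸ h2

lemma riesz_lower_inner (d N : ℕ) (a ε : ℝ) (ha : 0 < a) (hε : 0 < ε)
    (e : EuclideanSpace ℝ (Fin (d + 1))) (he : ‖e‖ = 1)
    (x : Fin N → EuclideanSpace ℝ (Fin (d + 1))) (hx : ∀ i, ‖x i‖ = 1) :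
    (N : ℝ) ^ 2 * ∫ y, (2 + ε - 2 * ⟪e, y⟫) ^ (-a) ∂(sphereMeasure d) ≤
      ∑ i, ∑ j, (2 + ε - 2 * ⟪x i, x j⟫) ^ (-a) := by
  obtain ⟨b, hb, hs⟩ := riesz_series a ε ha hε
  have hsum : Summable b := by simpa using (hs 1 (by simp)).summable
  have hcs : ∀ y z : EuclideanSpace ℝ (Fin (d + 1)), ‖y‖ = 1 → ‖z‖ = 1 → |⟪y, z⟫| ≤ 1 := by
    intro y z hy hz
    simpa [hy, hz] using abs_real_inner_le_norm y z
  have hbd : ∀ k, ∀ᵐ y ∂(sphereMeasure d), ‖b k * ⟪e, y⟫ ^ k‖ ≤ b k := by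
    intro k
    filter_upwards [riesz_ae_norm d] with y hy
    rw [norm_mul, norm_pow, Real.norm_eq_abs, abs_of_nonneg (hb k)]
    exact mul_le_of_le_one_right (hb k) (pow_le_one₀ (norm_nonneg _) (hcs e y he hy))
  have hintg : ∀ k, Integrable (fun y => b k * ⟪e, y⟫ ^ k) (sphereMeasure d) := fun k =>
    Integrable.of_bound (Continuous.aestronglyMeasurable (by fun_prop)) (b k) (hbd k)
  have h1 := hasSum_integral_of_summable_integral_norm hintg (by
    refine Summable.of_nonneg_of_le (fun k => integral_nonneg fun y => norm_nonneg _)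
      (fun k => ?_) hsum
    simpa using integral_mono_ae (hintg k).norm (integrable_const (b k)) (hbd k))
  have h2 : ∫ y, (∑' k, b k * ⟪e, y⟫ ^ k) ∂(sphereMeasure d) =
      ∫ y, (2 + ε - 2 * ⟪e, y⟫) ^ (-a) ∂(sphereMeasure d) := by
    refine integral_congr_ae ?_
    filter_upwards [riesz_ae_norm d] with y hy using (hs _ (hcs e y he hy)).tsum_eq
  rw [h2] at h1
  have h3 : HasSum (fun k => ∑ i, ∑ j, b k * ⟪x i, x j⟫ ^ k)
      (∑ i, ∑ j, (2 + ε - 2 * ⟪x i, x j⟫) ^ (-a)) :=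
    hasSum_sum fun i _ => hasSum_sum fun j _ => hs _ (hcs _ _ (hx i) (hx j))
  refine hasSum_le (fun k => ?_) (h1.mul_left ((N : ℝ) ^ 2)) h3
  have := mul_le_mul_of_nonneg_left (riesz_moment d k N e he x hx) (hb k)
  simp only [integral_const_mul, Finset.mul_sum] at this ⊢
  linarith

lemma riesz_inner_eq {d : ℕ} (x y : EuclideanSpace ℝ (Fin (d + 1))) (hx : ‖x‖ = 1)
    (hy : ‖y‖ = 1) (ε : ℝ) : 2 + ε - 2 * ⟪x, y⟫ = ε + ‖x - y‖ ^ 2 := by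
  rw [norm_sub_sq_real, hx, hy]; ring

lemma riesz_kernel_le (s ε r : ℝ) (hs : 0 < s) (hε : 0 < ε) (hr : 0 < r) :
    (ε + r ^ 2) ^ (-(s / 2)) ≤ r ^ (-s) := by
  have h : r ^ (-s) = (r ^ 2) ^ (-(s / 2)) := by
    rw [← Real.rpow_natCast, ← Real.rpow_mul hr.le]; congr 1; push_cast; ring
  rw [h]
  exact Real.rpow_le_rpow_of_nonpos (by positivity) (by linarith) (by linarith)

lemma riesz_lower (d N : ℕ) (s ε : ℝ) (hs : 0 < s) (hε : 0 < ε)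
    (e : EuclideanSpace ℝ (Fin (d + 1))) (he : ‖e‖ = 1)
    (x : Fin N → EuclideanSpace ℝ (Fin (d + 1))) (hinj : Function.Injective x)
    (hx : ∀ i, ‖x i‖ = 1) :
    (N : ℝ) ^ 2 * (∫ y, (ε + ‖e - y‖ ^ 2) ^ (-(s / 2)) ∂(sphereMeasure d)) - N * ε ^ (-(s / 2)) ≤
      ∑ i : Fin N, ∑ j : Fin N, if i = j then 0 else (‖x i - x j‖ ^ s)⁻¹ := by
  have h := riesz_lower_inner d N (s / 2) ε (by positivity) hε e he x hx
  have h1 : ∫ y, (2 + ε - 2 * ⟪e, y⟫) ^ (-(s / 2)) ∂(sphereMeasure d) =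
      ∫ y, (ε + ‖e - y‖ ^ 2) ^ (-(s / 2)) ∂(sphereMeasure d) := by
    refine integral_congr_ae ?_
    filter_upwards [riesz_ae_norm d] with y hy
    rw [riesz_inner_eq e y he hy]
  rw [h1] at h
  have h2 : ∑ i, ∑ j, (2 + ε - 2 * ⟪x i, x j⟫) ^ (-(s / 2)) ≤
      ∑ i : Fin N, ∑ j : Fin N, ((if i = j then 0 else (‖x i - x j‖ ^ s)⁻¹) +
        if i = j then ε ^ (-(s / 2)) else 0) := by
    refine Finset.sum_le_sum fun i _ => Finset.sum_le_sum fun j _ => ?_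
    rw [riesz_inner_eq _ _ (hx i) (hx j)]
    by_cases hij : i = j
    · simp [hij]
    · rw [if_neg hij, if_neg hij, add_zero, ← Real.rpow_neg (norm_nonneg _)]
      exact riesz_kernel_le s ε _ hs hε (norm_pos_iff.2 (sub_ne_zero.2 (hinj.ne hij)))
  simp only [Finset.sum_add_distrib, Finset.sum_ite_eq, Finset.mem_univ, if_true,
    Finset.sum_const, Finset.card_univ, Fintype.card_fin, nsmul_eq_mul] at h2
  linarith

lemma riesz_tendsto (d : ℕ) (hd : 1 ≤ d) (s : ℝ) (hs0 : 0 < s) (hsd : s < d)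
    (e : EuclideanSpace ℝ (Fin (d + 1))) (he : ‖e‖ = 1) :
    Tendsto (fun n : ℕ => ∫ y, (1 / ((n : ℝ) + 1) + ‖e - y‖ ^ 2) ^ (-(s / 2)) ∂(sphereMeasure d))
      atTop (nhds (∫ y, ‖e - y‖ ^ (-s) ∂(sphereMeasure d))) := by
  have hne : ∀ᵐ y ∂(sphereMeasure d), 0 < ‖e - y‖ := by
    have : ∀ᵐ y ∂(sphereMeasure d), y ∉ ({e} : Set (EuclideanSpace ℝ (Fin (d + 1)))) :=
      measure_eq_zero_iff_ae_notMem.1 (riesz_singleton d hd e)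
    filter_upwards [this] with y hy
    exact norm_pos_iff.2 (sub_ne_zero.2 fun h => hy h.symm)
  refine tendsto_integral_of_dominated_convergence _ (fun n => ?_)
    (riesz_integrable d s hs0 hsd e he) (fun n => ?_) ?_
  · exact Measurable.aestronglyMeasurable (by fun_prop)
  · filter_upwards [hne] with y hy
    rw [Real.norm_of_nonneg (by positivity)]
    exact riesz_kernel_le s _ _ hs0 (by positivity) hy
  · filter_upwards [hne] with y hy
    have h : ‖e - y‖ ^ (-s) = (0 + ‖e - y‖ ^ 2) ^ (-(s / 2)) := by
      rw [zero_add, ← Real.rpow_natCast, ← Real.rpow_mul hy.le]; congr 1; push_cast; ring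
    rw [h]
    refine Tendsto.rpow_const ?_ (Or.inl (by positivity))
    exact (tendsto_one_div_add_atTop_nhds_zero_nat).add_const _

lemma riesz_upper (d : ℕ) (hd : 1 ≤ d) (s : ℝ) (hs0 : 0 < s) (hsd : s < d)
    (e : EuclideanSpace ℝ (Fin (d + 1))) (he : ‖e‖ = 1) (N : ℕ) :
    ∃ x : Fin N → EuclideanSpace ℝ (Fin (d + 1)),
    Function.Injective x ∧ (∀ i, ‖x i‖ = 1) ∧
    ∑ i : Fin N, ∑ j : Fin N, (if i = j then 0 else (‖x i - x j‖ ^ s)⁻¹) ≤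
      N * (N - 1) * ∫ y, ‖e - y‖ ^ (-s) ∂(sphereMeasure d) := by
  set c := ∫ y, ‖e - y‖ ^ (-s) ∂(sphereMeasure d) with hc
  induction N with
  | zero => exact ⟨Fin.elim0, fun i => i.elim0, fun i => i.elim0, by simp⟩
  | succ N ih =>
    obtain ⟨x, hinj, hx, hE⟩ := ih
    have hintg : ∀ i, Integrable (fun y => ‖x i - y‖ ^ (-s)) (sphereMeasure d) :=
      fun i => riesz_integrable d s hs0 hsd (x i) (hx i)
    have hN : sphereMeasure d ({y | ¬ ‖y‖ = 1} ∪ ⋃ i, {x i}) = 0 := by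
      refine measure_union_null (riesz_ae_norm d) ?_
      exact measure_iUnion_null fun i => riesz_singleton d hd (x i)
    obtain ⟨y, hy, hyle⟩ := exists_notMem_null_le_integral
      (integrable_finsetSum Finset.univ fun i _ => hintg i) hN
    simp only [Set.mem_union, Set.mem_ofPred_eq, not_or, not_not, Set.mem_iUnion,
      Set.mem_singleton_iff, not_exists] at hy
    obtain ⟨hy1, hy2⟩ := hy
    rw [integral_finsetSum _ fun i _ => hintg i] at hyle
    have hci : ∀ i, ∫ y, ‖x i - y‖ ^ (-s) ∂(sphereMeasure d) = c := fun i => by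
      rw [hc, riesz_invariance d (x i) e (by rw [hx i, he]) (fun r => r ^ (-s))]
    simp only [hci, Finset.sum_const, Finset.card_univ, Fintype.card_fin, nsmul_eq_mul] at hyle
    refine ⟨Fin.cons y x, ?_, ?_, ?_⟩
    · refine Fin.cons_injective_iff.2 ⟨?_, hinj⟩
      rintro ⟨i, hi⟩
      exact hy2 i hi.symm
    · intro i
      refine Fin.cases ?_ (fun i => ?_) i
      · simpa using hy1
      · simpa using hx i
    · simp only [Fin.sum_univ_succ, Fin.cons_zero, Fin.cons_succ, if_true,
        Fin.succ_inj, Finset.sum_add_distrib, (Fin.succ_ne_zero _).symm, Fin.succ_ne_zero, if_false]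
      have e1 : ∑ i, (‖x i - y‖ ^ s)⁻¹ = ∑ i, ‖x i - y‖ ^ (-s) :=
        Finset.sum_congr rfl fun i _ => by rw [Real.rpow_neg (norm_nonneg _)]
      have e2 : ∑ i, (‖y - x i‖ ^ s)⁻¹ = ∑ i, ‖x i - y‖ ^ (-s) :=
        Finset.sum_congr rfl fun i _ => by rw [Real.rpow_neg (norm_nonneg _), norm_sub_rev]
      rw [e1, e2]
      push_cast
      nlinarith

end RieszLower

/-- for `0 < s < d`, the minimal `N`-point Riesz `s`-energy of `S^d` satisfies
`lim_{N→∞} ℰ_s(S^d; N)/N² = W_s(S^d) = ∫∫ ‖x-y‖^{-s} dσ_d dσ_d`. -/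
theorem minimal_riesz_energy_leading_term_potential_theoretic
    (d : ℕ) (hd : 1 ≤ d) (s : ℝ) (hs0 : 0 < s) (hsd : s < d) :
    Tendsto (fun N : ℕ => minRieszEnergy d s N / (N : ℝ) ^ 2) atTop
      (nhds (∫ x, ∫ y, ‖x - y‖ ^ (-s) ∂(sphereMeasure d) ∂(sphereMeasure d))) := by
  obtain ⟨e, he⟩ := riesz_exists_unit d
  have hW : ∫ x, ∫ y, ‖x - y‖ ^ (-s) ∂(sphereMeasure d) ∂(sphereMeasure d) =
      ∫ y, ‖e - y‖ ^ (-s) ∂(sphereMeasure d) := by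
    have : ∫ x, ∫ y, ‖x - y‖ ^ (-s) ∂(sphereMeasure d) ∂(sphereMeasure d) =
        ∫ x : EuclideanSpace ℝ (Fin (d + 1)), (∫ y, ‖e - y‖ ^ (-s) ∂(sphereMeasure d))
          ∂(sphereMeasure d) := by
      refine integral_congr_ae ?_
      filter_upwards [riesz_ae_norm d] with x hx
      exact riesz_invariance d x e (by rw [hx, he]) (fun r => r ^ (-s))
    rw [this]; simp
  rw [hW]
  have hlim := riesz_tendsto d hd s hs0 hsd e he
  have hup := riesz_upper d hd s hs0 hsd e he
  set c := ∫ y, ‖e - y‖ ^ (-s) ∂(sphereMeasure d) with hc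
  have hc0 : 0 ≤ c := integral_nonneg fun y => by positivity
  have hupper : ∀ N : ℕ, 0 < N → minRieszEnergy d s N / (N : ℝ) ^ 2 ≤ c := by
    intro N hN
    obtain ⟨x, hinj, hx, hE⟩ := hup N
    have h1 : minRieszEnergy d s N ≤ N * (N - 1) * c := by
      refine le_trans (csInf_le ?_ ⟨x, hinj, hx, rfl⟩) hE
      refine ⟨0, ?_⟩
      rintro E ⟨x, -, -, rfl⟩
      refine Finset.sum_nonneg fun i _ => Finset.sum_nonneg fun j _ => ?_
      split_ifs <;> positivity
    have hNp : (0 : ℝ) < N := by exact_mod_cast hN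
    rw [div_le_iff₀ (by positivity)]
    nlinarith [mul_nonneg hNp.le hc0]
  rw [Metric.tendsto_atTop]
  intro δ hδ
  obtain ⟨n, hn⟩ := (hlim.eventually (lt_mem_nhds (show c - δ / 2 < c by linarith))).exists
  set ε : ℝ := 1 / ((n : ℝ) + 1) with hεdef
  have hε : 0 < ε := by positivity
  set M : ℝ := ε ^ (-(s / 2)) with hM
  obtain ⟨N0, hN0⟩ := exists_nat_gt (2 * M / δ)
  refine ⟨N0 + 1, fun N hN => ?_⟩
  have hNpos : 0 < N := by omega
  have hNp : (0 : ℝ) < N := by exact_mod_cast hNpos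
  have hNN : 2 * M / δ < N := hN0.trans_le (by exact_mod_cast (by omega : N0 ≤ N))
  rw [div_lt_iff₀ hδ] at hNN
  have hu := hupper N hNpos
  have hl : (N : ℝ) ^ 2 * (c - δ / 2) - N * M ≤ minRieszEnergy d s N := by
    obtain ⟨x, hinj, hx, -⟩ := hup N
    refine le_csInf ⟨_, x, hinj, hx, rfl⟩ ?_
    rintro E ⟨x, hinj, hx, rfl⟩
    refine le_trans ?_ (riesz_lower d N s ε hs0 hε e he x hinj hx)
    gcongr
  have hl2 : c - δ < minRieszEnergy d s N / (N : ℝ) ^ 2 := by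
    rw [lt_div_iff₀ (by positivity)]
    nlinarith [mul_lt_mul_of_pos_left hNN hNp]
  rw [Real.dist_eq, abs_lt]
  constructor <;> linarith
end
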